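/- The language of Motzkin words (nonempty words over {u, d, x} of total height 0 all of whose prefixes have height ≥ 0) over the alphabet {u, d, x} with involution u* = d, x* = x is a Pythagorean language. -/

import Mathlib

/-- The involution on words induced by an involution `s` on letters. -/
def wordStar {G : Type*} (s : G → G) (w : List G) : List G :=
  (w.map s).reverse

/-- A language is self-adjoint if it is closed under the word involution. -/
def IsSelfAdjointLang {G : Type*} (s : G → G) (L : Set (List G)) : Prop :=
  ∀ w ∈ L, wordStar s w ∈ L

/-- A self-adjoint language `L` is Pythagorean if for all nonempty words `α, β, γ`:
whenever `β*α` and `γ*α` lie in `L`, then `α*α` and `γ*β` lie in `L`. -/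
def IsPythagorean {G : Type*} (s : G → G) (L : Set (List G)) : Prop :=
  IsSelfAdjointLang s L ∧
    ∀ α β γ : List G, α ≠ [] → β ≠ [] → γ ≠ [] →
      wordStar s β ++ α ∈ L → wordStar s γ ++ α ∈ L →
      wordStar s α ++ α ∈ L ∧ wordStar s γ ++ β ∈ L

/-- The three-letter alphabet `{u, d, x}`. -/
inductive MLetter : Type
  | u : MLetter
  | d : MLetter
  | x : MLetter

/-- The involution `u* = d`, `d* = u`, `x* = x`. -/
def mstar : MLetter → MLetter
  | .u => .d
  | .d => .u
  | .x => .x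

/-- Heights of letters: `u ↦ +1`, `d ↦ -1`, `x ↦ 0`. -/
def mheight : MLetter → ℤ
  | .u => 1
  | .d => -1
  | .x => 0

/-- The height of a word is the sum of the heights of its letters. -/
def mht (w : List MLetter) : ℤ := (w.map mheight).sum

/-- Motzkin words: nonempty words of total height `0` all of whose prefixes have
height `≥ 0`. -/
def MotzkinLang : Set (List MLetter) :=
  {w | w ≠ [] ∧ mht w = 0 ∧ ∀ p : List MLetter, p <+: w → 0 ≤ mht p}

theorem mht_append (v w : List MLetter) : mht (v ++ w) = mht v + mht w := by
  simp [mht]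

theorem mheight_mstar (a : MLetter) : mheight (mstar a) = -mheight a := by
  cases a <;> rfl

theorem mht_wordStar (w : List MLetter) : mht (wordStar mstar w) = -mht w := by
  induction w with
  | nil => rfl
  | cons a w ih =>
    have h : wordStar mstar (a :: w) = wordStar mstar w ++ [mstar a] := by simp [wordStar]
    rw [h, mht_append, ih, ← List.singleton_append (x := a), mht_append]
    simp [mht, mheight_mstar, add_comm]

theorem wordStar_append {G : Type*} (s : G → G) (v w : List G) :
    wordStar s (v ++ w) = wordStar s w ++ wordStar s v := by
  simp [wordStar]

theorem mstar_involutive : Function.Involutive mstar := by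
  intro a
  cases a <;> rfl

theorem wordStar_mstar_involutive : Function.Involutive (wordStar mstar) := by
  intro w
  simp [wordStar, mstar_involutive.comp_self]

/-- A word `β*α` of the Motzkin language is characterized by separate conditions on `α` and `β`
and the equality of their heights. -/
theorem wordStar_append_mem_motzkinLang (α β : List MLetter) :
    wordStar mstar β ++ α ∈ MotzkinLang ↔
      (β ≠ [] ∨ α ≠ []) ∧ mht α = mht β ∧
        (∀ v, v <:+ α → mht v ≤ 0) ∧ ∀ v, v <:+ β → mht v ≤ 0 := by
  have hne : wordStar mstar β ++ α ≠ [] ↔ β ≠ [] ∨ α ≠ [] := by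
    simp [wordStar]
    tauto
  have hht : mht (wordStar mstar β ++ α) = mht α - mht β := by
    rw [mht_append, mht_wordStar]
    ring
  refine and_congr hne ?_
  rw [hht, sub_eq_zero]
  refine and_congr_right fun h => ⟨fun hp => ⟨?_, ?_⟩, ?_⟩
  · rintro v ⟨p, rfl⟩
    have := hp (wordStar mstar β ++ p) ⟨v, by simp⟩
    rw [mht_append, mht_wordStar] at this
    rw [mht_append] at h
    linarith
  · rintro v ⟨p, rfl⟩
    have := hp (wordStar mstar v) ⟨wordStar mstar p ++ α, by simp [wordStar_append]⟩
    rw [mht_wordStar] at this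
    linarith
  · rintro ⟨hα, hβ⟩ p ⟨t, ht⟩
    rcases List.append_eq_append_iff.1 ht with ⟨r, hr, -⟩ | ⟨r, rfl, hr⟩
    · have := hβ (wordStar mstar p) ⟨wordStar mstar r, by
        rw [← wordStar_append, ← hr, wordStar_mstar_involutive]⟩
      rw [mht_wordStar] at this
      linarith
    · have := hα t ⟨r, hr.symm⟩
      rw [hr, mht_append] at h
      rw [mht_append, mht_wordStar]
      linarith

/-- The language of Motzkin words is Pythagorean. -/
theorem motzkin_isPythagorean : IsPythagorean mstar MotzkinLang := by
  refine ⟨fun w hw => ?_, fun α β γ hα hβ _ h₁ h₂ => ?_⟩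
  · obtain ⟨hne, hht, hw, hnil⟩ := (wordStar_append_mem_motzkinLang w []).1 hw
    rw [← List.append_nil (wordStar mstar w)]
    exact (wordStar_append_mem_motzkinLang [] w).2 ⟨hne.symm, hht.symm, hnil, hw⟩
  · rw [wordStar_append_mem_motzkinLang] at h₁ h₂ ⊢
    rw [wordStar_append_mem_motzkinLang]
    obtain ⟨-, hht₁, sα, sβ⟩ := h₁
    obtain ⟨-, hht₂, -, sγ⟩ := h₂
    exact ⟨⟨.inl hα, rfl, sα, sα⟩, .inr hβ, hht₁.symm.trans hht₂, sβ, sγ⟩
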